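/- Let s > 1/2, let V ⊆ ℝ^d be a linear subspace with k-dimensional Lebesgue (Hausdorff) measure σ_V, and let ρ(x) = ⟨R_r x, x⟩ + i⟨R_i x, x⟩ be a quadratic form on ℝ^d with R_r, R_i ∈ ℝ^{d×d} symmetric and R_i positive semidefinite (so that |e^{iρ(x)}| ≤ 1). Let u ∈ 𝒮'(ℝ^d) be the tempered distribution u(φ) = ∫_V e^{iρ(x)} φ(x) dσ_V(x). Then WF^s(u) ⊆ { (x, 2R_r x + η) : x ∈ V, η ∈ V^⊥ } \ {0}, where V^⊥ is the orthogonal complement of V. -/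

import Mathlib

open MeasureTheory Filter
open scoped BigOperators ENNReal RealInnerProductSpace

noncomputable section

/-- `ℝ^d` with the Euclidean norm. -/
abbrev Ed (d : ℕ) : Type := EuclideanSpace ℝ (Fin d)

/-- Partial derivative along the `i`-th coordinate direction. -/
def pdGS {d : ℕ} (i : Fin d) (f : Ed d → ℂ) : Ed d → ℂ :=
  fun x => fderiv ℝ f x (EuclideanSpace.single i 1)

/-- Multi-index partial derivative `∂^β`. -/
def mderiv {d : ℕ} (β : Fin d → ℕ) (f : Ed d → ℂ) : Ed d → ℂ :=
  ((List.ofFn fun i : Fin d => (pdGS i)^[β i]).foldr (· ∘ ·) id) f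

/-- Monomial `x^α`. -/
def mpow {d : ℕ} (x : Ed d) (α : Fin d → ℕ) : ℝ := ∏ i, x i ^ α i

/-- Multi-index factorial `α!`. -/
def mfact {d : ℕ} (α : Fin d → ℕ) : ℕ := ∏ i, Nat.factorial (α i)

/-- Multi-index length `|α|`. -/
def mlen {d : ℕ} (α : Fin d → ℕ) : ℕ := ∑ i, α i

/-- The Gelfand–Shilov seminorm `‖f‖_{S_{s,h}}`, valued in `[0,∞]`. -/
def GSnorm {d : ℕ} (s h : ℝ) (f : Ed d → ℂ) : ℝ≥0∞ :=
  ⨆ (x : Ed d) (α : Fin d → ℕ) (β : Fin d → ℕ),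
    ENNReal.ofReal (|mpow x α| * ‖mderiv β f x‖ /
      (h ^ (mlen α + mlen β) * ((mfact α : ℝ) * (mfact β : ℝ)) ^ s))

/-- The Gelfand–Shilov space `Σ_s(ℝ^d)`: smooth functions all of whose
`S_{s,h}` seminorms are finite. -/
def SigmaGS (s : ℝ) (d : ℕ) : Set (Ed d → ℂ) :=
  {f | ContDiff ℝ ((⊤ : ℕ∞) : WithTop ℕ∞) f ∧ ∀ h : ℝ, 0 < h → GSnorm s h f < ⊤}

/-- The seminorm `|f|_A`, valued in `[0,∞]`. -/
def GSnormA {d : ℕ} (s A : ℝ) (f : Ed d → ℂ) : ℝ≥0∞ :=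
  ⨆ (x : Ed d) (β : Fin d → ℕ),
    ENNReal.ofReal (A ^ mlen β * Real.exp (A * ‖x‖ ^ (1/s)) * ‖mderiv β f x‖ /
      (mfact β : ℝ) ^ s)

/-- The Fourier transform `f̂(ξ) = ∫ f(x) e^{-i⟨x,ξ⟩} dx`. -/
def FTgs {d : ℕ} (f : Ed d → ℂ) (ξ : Ed d) : ℂ :=
  ∫ x : Ed d, f x * Complex.exp (-(Complex.I * (⟪x, ξ⟫ : ℝ)))

/-- The short-time Fourier transform of a function `f` with window `φ`. -/
def STFTgs {d : ℕ} (φ f : Ed d → ℂ) (z : Ed d × Ed d) : ℂ :=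
  ∫ y : Ed d, f y * (starRingEnd ℂ) (φ (y - z.1)) * Complex.exp (-(Complex.I * (⟪y, z.2⟫ : ℝ)))

/-- Euclidean norm of a phase-space point `(x,ξ) ∈ ℝ^{2d}`. -/
def pnorm {d : ℕ} (z : Ed d × Ed d) : ℝ := Real.sqrt (‖z.1‖ ^ 2 + ‖z.2‖ ^ 2)

/-- A conic subset: invariant under multiplication by positive reals. -/
def IsConic {V : Type*} [SMul ℝ V] (Γ : Set V) : Prop :=
  ∀ t : ℝ, 0 < t → ∀ z ∈ Γ, t • z ∈ Γ

/-- Tempered distributions on `ℝ^d`. -/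
abbrev TD (d : ℕ) : Type := SchwartzMap (Ed d) ℂ →L[ℂ] ℂ

/-- `W` is the short-time Fourier transform `V_φ u` of the tempered distribution `u`
with respect to the window `φ`. -/
def IsSTFT {d : ℕ} (u : TD d) (φ : Ed d → ℂ) (W : Ed d × Ed d → ℂ) : Prop :=
  ∀ (x ξ : Ed d) (g : SchwartzMap (Ed d) ℂ),
    (∀ y : Ed d, g y = (starRingEnd ℂ) (φ (y - x)) * Complex.exp (-(Complex.I * (⟪y, ξ⟫ : ℝ)))) →
    W (x, ξ) = u g

/-- The `s`-Gelfand–Shilov wave front set of a distribution whose short-time Fourier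
transform is `W`: the set of nonzero phase-space points having no open conic
neighbourhood on which `e^{A|z|^{1/s}} |W(z)|` is bounded for every `A > 0`. -/
def WFs {d : ℕ} (s : ℝ) (W : Ed d × Ed d → ℂ) : Set (Ed d × Ed d) :=
  {z₀ | z₀ ≠ 0 ∧ ¬ ∃ Γ : Set (Ed d × Ed d), IsOpen Γ ∧ IsConic Γ ∧
    (0 : Ed d × Ed d) ∉ Γ ∧ z₀ ∈ Γ ∧
    ∀ A : ℝ, 0 < A → ∃ C : ℝ, ∀ z ∈ Γ, Real.exp (A * pnorm z ^ (1/s)) * ‖W z‖ ≤ C}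

/-- The real quadratic form `⟨Bx, x⟩` of a matrix `B`. -/
def qf {d : ℕ} (B : Matrix (Fin d) (Fin d) ℝ) (x : Ed d) : ℝ :=
  ∑ i, (∑ j, B i j * x j) * x i

/-- Tempered distributions on `ℝ^m × ℝ^n`. -/
abbrev TD2 (m n : ℕ) : Type := SchwartzMap (Ed m × Ed n) ℂ →L[ℂ] ℂ

/-- Short-time Fourier transform of a tempered distribution on `ℝ^m × ℝ^n`. -/
def IsSTFT2 {m n : ℕ} (w : TD2 m n) (Φ : Ed m × Ed n → ℂ)
    (W : (Ed m × Ed n) × (Ed m × Ed n) → ℂ) : Prop :=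
  ∀ (x ξ : Ed m × Ed n) (g : SchwartzMap (Ed m × Ed n) ℂ),
    (∀ y : Ed m × Ed n, g y = (starRingEnd ℂ) (Φ (y - x)) *
      Complex.exp (-(Complex.I * ((⟪y.1, ξ.1⟫ + ⟪y.2, ξ.2⟫ : ℝ))))) →
    W (x, ξ) = w g

/-- Euclidean norm of a phase-space point of `T^*(ℝ^m × ℝ^n)`. -/
def pnorm2 {m n : ℕ} (z : (Ed m × Ed n) × (Ed m × Ed n)) : ℝ :=
  Real.sqrt (‖z.1.1‖ ^ 2 + ‖z.1.2‖ ^ 2 + ‖z.2.1‖ ^ 2 + ‖z.2.2‖ ^ 2)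

/-- The `s`-Gelfand–Shilov wave front set on `ℝ^m × ℝ^n`. -/
def WFs2 {m n : ℕ} (s : ℝ) (W : (Ed m × Ed n) × (Ed m × Ed n) → ℂ) :
    Set ((Ed m × Ed n) × (Ed m × Ed n)) :=
  {z₀ | z₀ ≠ 0 ∧ ¬ ∃ Γ : Set ((Ed m × Ed n) × (Ed m × Ed n)), IsOpen Γ ∧ IsConic Γ ∧
    (0 : (Ed m × Ed n) × (Ed m × Ed n)) ∉ Γ ∧ z₀ ∈ Γ ∧
    ∀ A : ℝ, 0 < A → ∃ C : ℝ, ∀ z ∈ Γ, Real.exp (A * pnorm2 z ^ (1/s)) * ‖W z‖ ≤ C}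

/-- The iterated partial derivative along the directions listed in `l`. -/
def listDeriv {d : ℕ} (l : List (Fin d)) (f : Ed d → ℂ) : Ed d → ℂ := l.foldr pdGS f

lemma contDiff_pdGS {d : ℕ} (i : Fin d) {f : Ed d → ℂ}
    (hf : ContDiff ℝ ((⊤ : ℕ∞) : WithTop ℕ∞) f) :
    ContDiff ℝ ((⊤ : ℕ∞) : WithTop ℕ∞) (pdGS i f) :=
  (hf.fderiv_right (by simp)).clm_apply contDiff_const

lemma contDiff_listDeriv {d : ℕ} (l : List (Fin d)) {f : Ed d → ℂ}
    (hf : ContDiff ℝ ((⊤ : ℕ∞) : WithTop ℕ∞) f) :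
    ContDiff ℝ ((⊤ : ℕ∞) : WithTop ℕ∞) (listDeriv l f) := by
  induction l with
  | nil => exact hf
  | cons i l ih => exact contDiff_pdGS i ih

lemma pdGS_comm {d : ℕ} (i j : Fin d) {f : Ed d → ℂ}
    (hf : ContDiff ℝ ((⊤ : ℕ∞) : WithTop ℕ∞) f) :
    pdGS i (pdGS j f) = pdGS j (pdGS i f) := by
  have hf' : Differentiable ℝ (fderiv ℝ f) :=
    ((hf.fderiv_right (m := ((⊤ : ℕ∞) : WithTop ℕ∞)) (by simp)).differentiable (by simp))
  have key (v w x : Ed d) :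
      fderiv ℝ (fun x => fderiv ℝ f x v) x w = fderiv ℝ (fderiv ℝ f) x w v := by
    rw [fderiv_clm_apply (hf' x) (differentiableAt_const v)]
    simp
  ext x
  have hs : IsSymmSndFDerivAt ℝ f x := hf.contDiffAt.isSymmSndFDerivAt (by
    simp only [minSmoothness_of_isRCLikeNormedField]
    exact WithTop.coe_le_coe.2 le_top)
  change fderiv ℝ (fun x => fderiv ℝ f x _) x _ = fderiv ℝ (fun x => fderiv ℝ f x _) x _
  rw [key, key, hs]

lemma listDeriv_perm {d : ℕ} {l₁ l₂ : List (Fin d)} (h : l₁.Perm l₂) {f : Ed d → ℂ}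
    (hf : ContDiff ℝ ((⊤ : ℕ∞) : WithTop ℕ∞) f) : listDeriv l₁ f = listDeriv l₂ f := by
  induction h with
  | nil => rfl
  | cons i _ ih => exact congrArg (pdGS i) ih
  | swap i j l => exact pdGS_comm j i (contDiff_listDeriv l hf)
  | trans _ _ ih₁ ih₂ => exact ih₁.trans ih₂

lemma mderiv_eq_listDeriv {d : ℕ} (β : Fin d → ℕ) (f : Ed d → ℂ) :
    mderiv β f = listDeriv (List.ofFn fun i => List.replicate (β i) i).flatten f := by
  have key (L : List (Fin d)) :
      (L.map fun i => (pdGS i)^[β i]).foldr (· ∘ ·) id f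
        = listDeriv (L.map fun i => List.replicate (β i) i).flatten f := by
    induction L with
    | nil => rfl
    | cons i L ih =>
      simp only [List.map_cons, List.foldr_cons, Function.comp_apply, List.flatten_cons, ih,
        listDeriv, List.foldr_append]
      generalize List.foldr pdGS f _ = g
      induction β i with
      | zero => rfl
      | succ n ihn => rw [Function.iterate_succ_apply', ihn]; rfl
  have := key (List.finRange d)
  rwa [← List.ofFn_eq_map, ← List.ofFn_eq_map] at this

lemma listDeriv_eq_mderiv {d : ℕ} (l : List (Fin d)) {f : Ed d → ℂ}
    (hf : ContDiff ℝ ((⊤ : ℕ∞) : WithTop ℕ∞) f) :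
    listDeriv l f = mderiv (fun i => l.count i) f := by
  rw [mderiv_eq_listDeriv]
  refine listDeriv_perm (List.perm_iff_count.2 fun a => ?_) hf
  rw [List.count_flatten, List.map_ofFn, List.sum_ofFn]
  simp [List.count_replicate]

lemma iteratedFDeriv_basis_eq_listDeriv {d : ℕ} {f : Ed d → ℂ}
    (hf : ContDiff ℝ ((⊤ : ℕ∞) : WithTop ℕ∞) f) {n : ℕ} (σ : Fin n → Fin d) (x : Ed d) :
    iteratedFDeriv ℝ n f x (fun k => EuclideanSpace.single (σ k) (1 : ℝ))
      = listDeriv (List.ofFn σ) f x := by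
  induction n generalizing x with
  | zero => simp [listDeriv]
  | succ n ih =>
    rw [iteratedFDeriv_succ_apply_left, List.ofFn_succ]
    change _ = fderiv ℝ (listDeriv (List.ofFn fun i => σ i.succ) f) x _
    have : listDeriv (List.ofFn fun i => σ i.succ) f = fun x => iteratedFDeriv ℝ n f x
        (fun k => EuclideanSpace.single (σ k.succ) (1 : ℝ)) := by
      ext y; exact (ih _ y).symm
    rw [this]
    have hd : DifferentiableAt ℝ (iteratedFDeriv ℝ n f) x :=
      (hf.differentiable_iteratedFDeriv (WithTop.coe_lt_coe.2 (ENat.natCast_lt_top n))) x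
    have := (hd.hasFDerivAt.continuousMultilinear_apply_const
      (fun k => EuclideanSpace.single (σ k.succ) (1 : ℝ))).fderiv
    rw [this]
    rfl

lemma norm_iteratedFDeriv_le_of_basis {d n : ℕ} {f : Ed d → ℂ} {x : Ed d} {B : ℝ}
    (hB : ∀ σ : Fin n → Fin d,
      ‖iteratedFDeriv ℝ n f x (fun k => EuclideanSpace.single (σ k) (1 : ℝ))‖ ≤ B)
    (hB0 : 0 ≤ B) : ‖iteratedFDeriv ℝ n f x‖ ≤ (d : ℝ) ^ n * B := by
  refine ContinuousMultilinearMap.opNorm_le_bound (by positivity) fun m => ?_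
  have hm : m = fun k => ∑ i : Fin d, (m k i) • EuclideanSpace.single i (1 : ℝ) := by
    ext k j
    simp [Finset.sum_apply, Pi.single_apply]
  conv_lhs => rw [hm]
  rw [ContinuousMultilinearMap.map_sum]
  calc _ ≤ ∑ _σ : Fin n → Fin d, B * ∏ k, ‖m k‖ := by
        refine (norm_sum_le _ _).trans (Finset.sum_le_sum fun σ _ => ?_)
        rw [ContinuousMultilinearMap.map_smul_univ, norm_smul, mul_comm, norm_prod]
        gcongr with k
        · exact hB σ
        · exact PiLp.norm_apply_le (m k) (σ k)
    _ = _ := by simp [mul_assoc]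

lemma exists_norm_pow_le_mpow {d : ℕ} (x : Ed d) (m : ℕ) :
    ‖x‖ ^ m = 0 ∨ ∃ α : Fin d → ℕ, mlen α = m ∧ mfact α = m.factorial ∧
      ‖x‖ ^ m ≤ (d : ℝ) ^ m * |mpow x α| := by
  rcases Nat.eq_zero_or_pos m with rfl | hm
  · exact Or.inr ⟨0, by simp [mlen], by simp [mfact], by simp [mpow]⟩
  rcases Nat.eq_zero_or_pos d with rfl | hd
  · left
    rw [Subsingleton.elim x 0]; simp [hm.ne']
  right
  have : Nonempty (Fin d) := ⟨⟨0, hd⟩⟩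
  obtain ⟨i, hi⟩ := Finite.exists_max fun i => ‖x i‖
  have hx : ‖x‖ ≤ d * |x i| := by
    have : x = ∑ j : Fin d, (x j) • EuclideanSpace.single j (1 : ℝ) := by
      ext j; simp [Finset.sum_apply, Pi.single_apply]
    conv_lhs => rw [this]
    calc _ ≤ ∑ j : Fin d, |x i| := by
          refine (norm_sum_le _ _).trans (Finset.sum_le_sum fun j _ => ?_)
          simpa [norm_smul] using hi j
      _ = _ := by simp
  refine ⟨Pi.single i m, by simp [mlen], ?_, ?_⟩
  · rw [mfact, Finset.prod_eq_single i] <;> simp +contextual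
  · have : mpow x (Pi.single i m) = x i ^ m := by
      rw [mpow, Finset.prod_eq_single i] <;> simp +contextual
    rw [this, abs_pow, ← mul_pow]
    gcongr

/-- All derivatives of `f` satisfy Gelfand–Shilov bounds of Beurling type. -/
def GSBound {d : ℕ} (s : ℝ) (f : Ed d → ℂ) : Prop :=
  ∀ h : ℝ, 0 < h → ∃ C : ℝ, 0 ≤ C ∧ ∀ (m j : ℕ) (x : Ed d),
    ‖x‖ ^ m * ‖iteratedFDeriv ℝ j f x‖ ≤ C * h ^ (m + j) * ((m.factorial * j.factorial : ℝ)) ^ s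

lemma gsBound_of_mem_SigmaGS {d : ℕ} {s : ℝ} (hs : 0 ≤ s) {f : Ed d → ℂ}
    (hf : f ∈ SigmaGS s d) : GSBound s f := by
  intro h hh
  obtain ⟨hsm, hfin⟩ := hf
  set h' : ℝ := h / (d + 1) with hh'
  have h'0 : 0 < h' := by positivity
  have hd : (d : ℝ) * h' ≤ h := by
    rw [hh', ← mul_div_assoc, div_le_iff₀ (by positivity)]; nlinarith
  set C := (GSnorm s h' f).toReal with hC
  have hC0 : 0 ≤ C := ENNReal.toReal_nonneg
  have hbound (x : Ed d) (α β : Fin d → ℕ) : |mpow x α| * ‖mderiv β f x‖ ≤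
      C * (h' ^ (mlen α + mlen β) * ((mfact α : ℝ) * (mfact β : ℝ)) ^ s) := by
    have h1 : ENNReal.ofReal (|mpow x α| * ‖mderiv β f x‖ /
      (h' ^ (mlen α + mlen β) * ((mfact α : ℝ) * (mfact β : ℝ)) ^ s)) ≤ GSnorm s h' f :=
      le_iSup_of_le x (le_iSup_of_le α (le_iSup_of_le β le_rfl))
    have hα : 0 < mfact α := Finset.prod_pos fun i _ => Nat.factorial_pos _
    have hβ : 0 < mfact β := Finset.prod_pos fun i _ => Nat.factorial_pos _
    have h2 := (ENNReal.ofReal_le_iff_le_toReal (hfin h' h'0).ne).1 h1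
    rwa [div_le_iff₀ (by positivity)] at h2
  refine ⟨C, hC0, fun m j x => ?_⟩
  have hR : 0 ≤ C * h ^ (m + j) * ((m.factorial * j.factorial : ℝ)) ^ s := by positivity
  rcases exists_norm_pow_le_mpow x m with h0 | ⟨α, hα, hα', hα''⟩
  · rw [h0, zero_mul]; exact hR
  have hB (σ : Fin j → Fin d) : |mpow x α| *
      ‖iteratedFDeriv ℝ j f x (fun k => EuclideanSpace.single (σ k) (1 : ℝ))‖ ≤
      C * (h' ^ (m + j) * ((m.factorial : ℝ) * (j.factorial : ℝ)) ^ s) := by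
    rw [iteratedFDeriv_basis_eq_listDeriv hsm, listDeriv_eq_mderiv _ hsm]
    have hlen : mlen (fun i => (List.ofFn σ).count i) = j := by
      simp only [mlen]
      have := Multiset.sum_count_eq_card (s := Finset.univ) (m := (List.ofFn σ : Multiset (Fin d)))
        (by simp)
      simpa using this
    have hfact : mfact (fun i => (List.ofFn σ).count i) ≤ j.factorial := by
      conv_rhs => rw [← hlen]
      exact Nat.le_of_dvd (Nat.factorial_pos _) (Nat.prod_factorial_dvd_factorial_sum _ _)
    refine (hbound x α _).trans ?_
    rw [hα, hlen, hα']
    gcongr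
  rcases eq_or_lt_of_le (abs_nonneg (mpow x α)) with h0 | hpos
  · rw [← h0, mul_zero] at hα''
    rw [le_antisymm hα'' (by positivity), zero_mul]; exact hR
  have := norm_iteratedFDeriv_le_of_basis (n := j) (f := f) (x := x)
    (fun σ => (le_div_iff₀' hpos).2 (hB σ)) (by positivity)
  calc _ ≤ ((d : ℝ) ^ m * |mpow x α|) * ((d : ℝ) ^ j * (C * (h' ^ (m + j) *
        ((m.factorial : ℝ) * (j.factorial : ℝ)) ^ s) / |mpow x α|)) := by gcongr
    _ = C * (d * h') ^ (m + j) * ((m.factorial * j.factorial : ℝ)) ^ s := by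
        field_simp; ring
    _ ≤ _ := by gcongr

lemma exp_mul_le_of_pow_mul_le {X a C δ : ℝ} (hδ : 0 < δ)
    (H : ∀ n : ℕ, X ^ n * a ≤ C * δ ^ n * n.factorial) : Real.exp (X / (2 * δ)) * a ≤ 2 * C := by
  have h1 : HasSum (fun n : ℕ => (X / (2 * δ)) ^ n / n.factorial * a)
      (Real.exp (X / (2 * δ)) * a) := by
    rw [Real.exp_eq_exp_ℝ]
    exact (NormedSpace.expSeries_div_hasSum_exp (X / (2 * δ))).mul_right a
  have h2 : HasSum (fun n : ℕ => C * (1 / 2 : ℝ) ^ n) (C * 2) := hasSum_geometric_two.mul_left C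
  rw [mul_comm 2 C]
  refine hasSum_le (fun n => ?_) h1 h2
  have hf : (0 : ℝ) < n.factorial := by positivity
  have : (X / (2 * δ)) ^ n / n.factorial * a
      = (X ^ n * a) / (δ ^ n * n.factorial) * (1 / 2) ^ n := by
    rw [div_pow, div_pow, mul_pow, one_pow]
    field_simp
  rw [this]
  gcongr
  rw [div_le_iff₀ (by positivity)]
  linarith [H n]

lemma pnorm_smul {d : ℕ} {t : ℝ} (ht : 0 < t) (z : Ed d × Ed d) : pnorm (t • z) = t * pnorm z := by
  simp only [pnorm, Prod.smul_fst, Prod.smul_snd, norm_smul, Real.norm_of_nonneg ht.le]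
  rw [show (t * ‖z.1‖) ^ 2 + (t * ‖z.2‖) ^ 2 = t ^ 2 * (‖z.1‖ ^ 2 + ‖z.2‖ ^ 2) by ring,
    Real.sqrt_mul (by positivity), Real.sqrt_sq ht.le]

lemma notMem_WFs_of_pow_mul_le {d : ℕ} {s : ℝ} (hs : 0 < s) {W : Ed d × Ed d → ℂ}
    {F : Type*} [NormedAddCommGroup F] [NormedSpace ℝ F] (L : Ed d × Ed d →L[ℝ] F)
    (H : ∀ h : ℝ, 0 < h → ∃ C : ℝ, 0 ≤ C ∧ ∀ (n : ℕ) (z : Ed d × Ed d),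
      ‖L z‖ ^ n * ‖W z‖ ≤ C * h ^ n * (n.factorial : ℝ) ^ s)
    {z₀ : Ed d × Ed d} (hz₀ : L z₀ ≠ 0) : z₀ ∉ WFs s W := by
  rintro ⟨-, hz⟩
  apply hz
  have hL : 0 < ‖L z₀‖ := norm_pos_iff.2 hz₀
  have hp (z : Ed d × Ed d) : 0 ≤ pnorm z := Real.sqrt_nonneg _
  set c : ℝ := ‖L z₀‖ / (2 * (pnorm z₀ + 1)) with hc
  have hp0 := hp z₀
  have hc0 : 0 < c := by positivity
  refine ⟨{z | c * pnorm z < ‖L z‖}, ?_, ?_, ?_, ?_, fun A hA => ?_⟩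
  · refine isOpen_lt ?_ (by fun_prop)
    unfold pnorm
    fun_prop
  · intro t ht z hz
    simp only [Set.mem_ofPred_eq, map_smul, norm_smul, pnorm_smul ht, Real.norm_of_nonneg ht.le]
      at hz ⊢
    rw [mul_left_comm]
    gcongr
  · simp [pnorm]
  · change c * pnorm z₀ < ‖L z₀‖
    rw [hc, div_mul_eq_mul_div, div_lt_iff₀ (by positivity)]
    nlinarith
  · set δ : ℝ := s / (2 * A) with hδ
    have hδ0 : 0 < δ := by positivity
    obtain ⟨C, hC, HC⟩ := H (c * δ ^ s) (by positivity)
    refine ⟨(2 * C ^ (1 / s)) ^ s, fun z hz => ?_⟩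
    have key (n : ℕ) : (pnorm z ^ (1 / s)) ^ n * ‖W z‖ ^ (1 / s)
        ≤ C ^ (1 / s) * δ ^ n * n.factorial := by
      have h1 : pnorm z ^ n * ‖W z‖ ≤ C * (δ ^ s) ^ n * (n.factorial : ℝ) ^ s := by
        have h2 : (c * pnorm z) ^ n * ‖W z‖ ≤ ‖L z‖ ^ n * ‖W z‖ := by
          have hz' : c * pnorm z ≤ ‖L z‖ := le_of_lt (by simpa using hz)
          have := mul_nonneg hc0.le (hp z)
          gcongr
        have h3 := h2.trans (HC n z)
        rw [mul_pow, mul_pow] at h3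
        have hcn : 0 < c ^ n := by positivity
        refine le_of_mul_le_mul_left ?_ hcn
        linarith
      have h4 := Real.rpow_le_rpow (mul_nonneg (pow_nonneg (hp z) n) (norm_nonneg _)) h1
        (by positivity : 0 ≤ 1 / s)
      rw [Real.mul_rpow (pow_nonneg (hp z) n) (norm_nonneg _),
        Real.mul_rpow (by positivity) (by positivity), Real.mul_rpow hC (by positivity)] at h4
      have e1 : ((n.factorial : ℝ) ^ s) ^ (1 / s) = n.factorial := by
        rw [← Real.rpow_mul (by positivity), mul_one_div_cancel hs.ne', Real.rpow_one]
      have e2 : ((δ ^ s) ^ n) ^ (1 / s) = δ ^ n := by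
        rw [← Real.rpow_natCast, ← Real.rpow_mul hδ0.le, ← Real.rpow_mul hδ0.le,
          show s * n * (1 / s) = n by field_simp, Real.rpow_natCast]
      have e3 : (pnorm z ^ n) ^ (1 / s) = (pnorm z ^ (1 / s)) ^ n := by
        rw [← Real.rpow_natCast, ← Real.rpow_natCast, ← Real.rpow_mul (hp z),
          ← Real.rpow_mul (hp z), mul_comm]
      rwa [e1, e2, e3] at h4
    have h5 := exp_mul_le_of_pow_mul_le hδ0 key
    have h6 := Real.rpow_le_rpow (by positivity) h5 hs.le
    rw [Real.mul_rpow (by positivity) (by positivity), ← Real.exp_mul,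
      ← Real.rpow_mul (norm_nonneg _), one_div_mul_cancel hs.ne', Real.rpow_one] at h6
    convert h6 using 3
    rw [hδ]; field_simp

/-- Hermite-type polynomials: if `a` is the logarithmic derivative of a Gaussian `G` and `κ` the
derivative of `a`, then the `n`-th derivative of `G` is `gaussPoly κ n a * G`. -/
def gaussPoly (κ : ℂ) : ℕ → ℂ → ℂ
  | 0, _ => 1
  | 1, a => a
  | n + 2, a => a * gaussPoly κ (n + 1) a + (n + 1) * κ * gaussPoly κ n a

lemma gaussPoly_succ (κ : ℂ) (n : ℕ) (a : ℂ) :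
    gaussPoly κ (n + 1) a = a * gaussPoly κ n a + n * κ * gaussPoly κ (n - 1) a := by
  cases n with
  | zero => simp [gaussPoly]
  | succ n => simp [gaussPoly]

lemma hasDerivAt_gaussPoly (κ : ℂ) (n : ℕ) (a : ℂ) :
    HasDerivAt (gaussPoly κ n) (n * gaussPoly κ (n - 1) a) a := by
  induction n using Nat.twoStepInduction with
  | zero => simpa [gaussPoly] using hasDerivAt_const a (1 : ℂ)
  | one => simpa [gaussPoly] using hasDerivAt_id' a
  | more n ih₀ ih₁ =>
    have := ((hasDerivAt_id a).mul ih₁).add (ih₀.const_mul ((n + 1) * κ))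
    refine this.congr_deriv ?_
    simp only [id, Nat.add_sub_cancel, show n + 2 - 1 = n + 1 from rfl]
    rw [gaussPoly_succ κ n]
    push_cast
    ring

lemma norm_gaussPoly_le {κ : ℂ} {c : ℝ} (hc : 0 ≤ c) (hκ : ‖κ‖ ≤ c ^ 2) (n : ℕ) (a : ℂ) :
    ‖gaussPoly κ n a‖ ≤ (‖a‖ + c * √n) ^ n := by
  induction n using Nat.twoStepInduction with
  | zero => simp [gaussPoly]
  | one => simp [gaussPoly, hc]
  | more n ih₀ ih₁ =>
    set b : ℝ := ‖a‖ + c * √((n + 2 : ℕ) : ℝ) with hb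
    have hb0 : 0 ≤ b := by positivity
    have h0 : ‖gaussPoly κ n a‖ ≤ b ^ n := ih₀.trans (by
      rw [hb]; gcongr; omega)
    have h1 : ‖gaussPoly κ (n + 1) a‖ ≤ b ^ (n + 1) := ih₁.trans (by
      rw [hb]; gcongr; omega)
    have hcb : c * √((n + 2 : ℕ) : ℝ) ≤ b := by rw [hb]; linarith [norm_nonneg a]
    have hn : ((n : ℝ) + 1) * c ^ 2 ≤ c * √((n + 2 : ℕ) : ℝ) * b := by
      have hsq := Real.sq_sqrt (by positivity : (0 : ℝ) ≤ ((n + 2 : ℕ) : ℝ))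
      calc ((n : ℝ) + 1) * c ^ 2 ≤ (c * √((n + 2 : ℕ) : ℝ)) * (c * √((n + 2 : ℕ) : ℝ)) := by
            rw [show (c * √((n + 2 : ℕ) : ℝ)) * (c * √((n + 2 : ℕ) : ℝ))
              = √((n + 2 : ℕ) : ℝ) ^ 2 * c ^ 2 by ring, hsq]
            push_cast
            gcongr
            norm_num
        _ ≤ _ := by gcongr
    calc ‖gaussPoly κ (n + 2) a‖
        ≤ ‖a‖ * ‖gaussPoly κ (n + 1) a‖ + ((n + 1) * ‖κ‖) * ‖gaussPoly κ n a‖ := by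
          rw [gaussPoly]
          refine (norm_add_le _ _).trans (le_of_eq ?_)
          simp only [norm_mul]
          congr 3
          exact_mod_cast Complex.norm_natCast (n + 1)
      _ ≤ ‖a‖ * b ^ (n + 1) + (c * √((n + 2 : ℕ) : ℝ) * b) * b ^ n := by
          exact add_le_add (mul_le_mul_of_nonneg_left h1 (norm_nonneg _))
            (mul_le_mul ((mul_le_mul_of_nonneg_left hκ (by positivity)).trans hn) h0
              (norm_nonneg _) (by positivity))
      _ = b ^ (n + 2) := by rw [hb]; ring

lemma sqrt_factorial_le {s δ : ℝ} (hs : 1 / 2 < s) (hδ : 0 < δ) :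
    ∃ C : ℝ, 0 ≤ C ∧ ∀ m : ℕ, √(m.factorial : ℝ) ≤ C * δ ^ m * (m.factorial : ℝ) ^ s := by
  set ε : ℝ := s - 1 / 2 with hε
  have hε0 : 0 < ε := by rw [hε]; linarith
  set y : ℝ := δ⁻¹ ^ (1 / ε) with hy
  have hy0 : 0 ≤ y := by positivity
  refine ⟨Real.exp y ^ ε, by positivity, fun m => ?_⟩
  have hm : (0 : ℝ) < m.factorial := by positivity
  have h1 : y ^ m ≤ Real.exp y * m.factorial := by
    have := Real.pow_div_factorial_le_exp y hy0 m
    rwa [div_le_iff₀ hm] at this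
  have h2 := Real.rpow_le_rpow (by positivity) h1 hε0.le
  have h3 : (y ^ m) ^ ε = (δ ^ m)⁻¹ := by
    rw [hy, ← Real.rpow_natCast, ← Real.rpow_mul (by positivity), ← Real.rpow_mul (by positivity),
      show 1 / ε * (m * ε) = m by field_simp, Real.rpow_natCast, inv_pow]
  rw [h3, Real.mul_rpow (by positivity) (by positivity), inv_le_iff_one_le_mul₀' (by positivity)]
    at h2
  have h4 : (m.factorial : ℝ) ^ s = (m.factorial : ℝ) ^ ε * √(m.factorial : ℝ) := by
    rw [Real.sqrt_eq_rpow, ← Real.rpow_add hm, hε]; congr 1; ring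
  rw [h4]
  calc √(m.factorial : ℝ) = 1 * √(m.factorial : ℝ) := (one_mul _).symm
    _ ≤ (δ ^ m * (Real.exp y ^ ε * (m.factorial : ℝ) ^ ε)) * √(m.factorial : ℝ) := by gcongr
    _ = _ := by ring

lemma exp_neg_sq_mul_pow_le (t : ℝ) (m : ℕ) :
    Real.exp (-t ^ 2) * t ^ m ≤ √(m.factorial : ℝ) := by
  have h1 : (t ^ 2) ^ m ≤ Real.exp (t ^ 2) * m.factorial := by
    have := Real.pow_div_factorial_le_exp (t ^ 2) (by positivity) m
    rwa [div_le_iff₀ (by positivity)] at this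
  refine Real.le_sqrt_of_sq_le ?_
  have h2 : Real.exp (-t ^ 2) ≤ 1 := Real.exp_le_one_iff.2 (by nlinarith)
  have h3 : Real.exp (-t ^ 2) * Real.exp (t ^ 2) = 1 := by rw [← Real.exp_add]; simp
  calc (Real.exp (-t ^ 2) * t ^ m) ^ 2
      = Real.exp (-t ^ 2) * (Real.exp (-t ^ 2) * (t ^ 2) ^ m) := by ring
    _ ≤ 1 * (Real.exp (-t ^ 2) * (Real.exp (t ^ 2) * m.factorial)) := by gcongr
    _ = m.factorial := by rw [← mul_assoc, ← mul_assoc, one_mul, h3, one_mul]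

lemma sqrt_pow_self_le (m : ℕ) : √(m : ℝ) ^ m ≤ 2 ^ m * √(m.factorial : ℝ) := by
  have h1 : (m : ℝ) ^ m ≤ Real.exp m * m.factorial := by
    have := Real.pow_div_factorial_le_exp (m : ℝ) (by positivity) m
    rwa [div_le_iff₀ (by positivity)] at this
  have h2 : Real.exp m ≤ 4 ^ m := by
    rw [← Real.exp_one_pow]
    gcongr
    linarith [Real.exp_one_lt_d9]
  refine (sq_le_sq₀ (by positivity) (by positivity)).1 ?_
  rw [mul_pow, Real.sq_sqrt (by positivity), ← pow_mul, mul_comm m 2, pow_mul,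
    Real.sq_sqrt (by positivity), ← pow_mul, mul_comm m 2, pow_mul]
  norm_num
  exact h1.trans (by gcongr)

lemma add_add_pow_le {x y z : ℝ} (hx : 0 ≤ x) (hy : 0 ≤ y) (hz : 0 ≤ z) (m : ℕ) :
    (x + y + z) ^ m ≤ 3 ^ m * (x ^ m + y ^ m + z ^ m) := by
  have hxm := pow_nonneg hx m
  have hym := pow_nonneg hy m
  have hzm := pow_nonneg hz m
  have key (w : ℝ) (h : x + y + z ≤ 3 * w) (hw : w ^ m ≤ x ^ m + y ^ m + z ^ m) :
      (x + y + z) ^ m ≤ 3 ^ m * (x ^ m + y ^ m + z ^ m) := by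
    calc (x + y + z) ^ m ≤ (3 * w) ^ m := by gcongr
      _ = 3 ^ m * w ^ m := mul_pow _ _ _
      _ ≤ _ := by gcongr
  rcases le_total x y with h1 | h1 <;> rcases le_total y z with h2 | h2 <;>
    rcases le_total x z with h3 | h3
  all_goals first
    | exact key x (by linarith) (by linarith)
    | exact key y (by linarith) (by linarith)
    | exact key z (by linarith) (by linarith)

lemma exp_neg_sq_mul_add_pow_le {K c r t : ℝ} (hK : 0 ≤ K) (hc : 0 ≤ c) (hr : 0 ≤ r) (ht : 0 ≤ t)
    (m : ℕ) : Real.exp (-t ^ 2) * (K * (r + t) + c * √m) ^ m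
      ≤ 2 * ((3 * (K + 2 * c + 1)) ^ m * (r ^ m + √(m.factorial : ℝ))) := by
  have h2 : Real.exp (-t ^ 2) ≤ 1 := Real.exp_le_one_iff.2 (by nlinarith)
  have h3 := add_add_pow_le (mul_nonneg hK hr) (mul_nonneg hK ht)
    (mul_nonneg hc (Real.sqrt_nonneg (m : ℝ))) m
  set D : ℝ := K + 2 * c + 1 with hD
  have hKD : K ^ m ≤ D ^ m := by gcongr; linarith
  have hcD : (2 * c) ^ m ≤ D ^ m := by gcongr; linarith
  calc Real.exp (-t ^ 2) * (K * (r + t) + c * √m) ^ m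
      ≤ Real.exp (-t ^ 2) * (3 ^ m * ((K * r) ^ m + (K * t) ^ m + (c * √m) ^ m)) := by
        rw [mul_add]; gcongr
    _ = 3 ^ m * (K ^ m * (Real.exp (-t ^ 2) * r ^ m) + K ^ m * (Real.exp (-t ^ 2) * t ^ m)
          + c ^ m * (Real.exp (-t ^ 2) * √m ^ m)) := by simp only [mul_pow]; ring
    _ ≤ 3 ^ m * (K ^ m * (1 * r ^ m) + K ^ m * √(m.factorial : ℝ)
          + c ^ m * (1 * (2 ^ m * √(m.factorial : ℝ)))) := by
        gcongr
        · exact exp_neg_sq_mul_pow_le t m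
        · exact sqrt_pow_self_le m
    _ = 3 ^ m * (K ^ m * r ^ m + K ^ m * √(m.factorial : ℝ)
          + (2 * c) ^ m * √(m.factorial : ℝ)) := by rw [mul_pow 2 c]; ring
    _ ≤ 3 ^ m * (D ^ m * r ^ m + D ^ m * √(m.factorial : ℝ)
          + D ^ m * √(m.factorial : ℝ)) := by gcongr
    _ ≤ 3 ^ m * (2 * (D ^ m * (r ^ m + √(m.factorial : ℝ)))) := by
        gcongr
        have : 0 ≤ D ^ m * r ^ m := by positivity
        linarith
    _ = _ := by rw [mul_pow]; ring

lemma factorial_add_le (m N : ℕ) :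
    ((m + N).factorial : ℝ) ≤ 2 ^ (m + N) * (m.factorial * N.factorial) := by
  have h := Nat.add_choose_mul_factorial_mul_factorial m N
  have h2 := Nat.choose_le_two_pow (m + N) N
  have : (m + N).factorial ≤ 2 ^ (m + N) * (m.factorial * N.factorial) := by
    rw [← h, mul_assoc]
    gcongr
  exact_mod_cast this

lemma GSBound.weighted {d : ℕ} {s : ℝ} (hs : 1 / 2 < s) {f : Ed d → ℂ} (hf : GSBound s f)
    {D : ℝ} (hD : 1 ≤ D) (N : ℕ) {h : ℝ} (hh : 0 < h) :
    ∃ C : ℝ, 0 ≤ C ∧ ∀ (m j : ℕ) (x : Ed d),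
      ‖x‖ ^ N * (D ^ m * (‖x‖ ^ m + √(m.factorial : ℝ))) * ‖iteratedFDeriv ℝ j f x‖
        ≤ C * h ^ (m + j) * ((m + j).factorial : ℝ) ^ s := by
  have hs0 : 0 < s := by linarith
  have h2s : (1 : ℝ) ≤ 2 ^ s := Real.one_le_rpow (by norm_num) hs0.le
  set δ : ℝ := h / (D * 2 ^ s) with hδ
  have hδ0 : 0 < δ := by positivity
  have hδh : D * 2 ^ s * δ = h := by rw [hδ]; field_simp
  obtain ⟨C₁, hC₁, H₁⟩ := hf δ hδ0
  obtain ⟨C₂, hC₂, H₂⟩ := sqrt_factorial_le hs hδ0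
  set Q : ℝ := (2 ^ s) ^ N * δ ^ N * (N.factorial : ℝ) ^ s with hQ
  set Q' : ℝ := δ ^ N * (N.factorial : ℝ) ^ s with hQ'
  refine ⟨C₁ * Q + C₂ * (C₁ * Q'), by positivity, fun m j x => ?_⟩
  set I : ℝ := ‖iteratedFDeriv ℝ j f x‖ with hI
  have hfac : (m.factorial : ℝ) ^ s * (j.factorial : ℝ) ^ s ≤ ((m + j).factorial : ℝ) ^ s := by
    rw [← Real.mul_rpow (by positivity) (by positivity)]
    gcongr
    exact_mod_cast Nat.le_of_dvd (Nat.factorial_pos _) (Nat.factorial_mul_factorial_dvd_factorial_add m j)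
  have hpow (E : ℝ) (hE : 0 ≤ E) (hE' : E ≤ 2 ^ s) : (D * E * δ) ^ m * δ ^ j ≤ h ^ (m + j) := by
    rw [pow_add]
    gcongr
    · rw [← hδh]; gcongr
    · rw [← hδh]
      exact le_mul_of_one_le_left hδ0.le (one_le_mul_of_one_le_of_one_le hD h2s)
  have h1 : D ^ m * (‖x‖ ^ (m + N) * I) ≤ C₁ * Q * h ^ (m + j) * ((m + j).factorial : ℝ) ^ s := by
    have hF : (((m + N).factorial : ℝ) * j.factorial) ^ s
        ≤ (2 ^ s) ^ (m + N) * ((m.factorial : ℝ) ^ s * (N.factorial : ℝ) ^ s)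
          * (j.factorial : ℝ) ^ s := by
      rw [Real.mul_rpow (by positivity) (by positivity)]
      gcongr
      refine (Real.rpow_le_rpow (by positivity) (factorial_add_le m N) hs0.le).trans (le_of_eq ?_)
      rw [Real.mul_rpow (by positivity) (by positivity),
        Real.mul_rpow (by positivity) (by positivity), ← Real.rpow_natCast 2,
        ← Real.rpow_natCast (2 ^ s), ← Real.rpow_mul (by norm_num), ← Real.rpow_mul (by norm_num),
        mul_comm s]
    calc D ^ m * (‖x‖ ^ (m + N) * I)
        ≤ D ^ m * (C₁ * δ ^ (m + N + j) * ((2 ^ s) ^ (m + N) * ((m.factorial : ℝ) ^ s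
          * (N.factorial : ℝ) ^ s) * (j.factorial : ℝ) ^ s)) := by
          refine mul_le_mul_of_nonneg_left ((H₁ (m + N) j x).trans ?_) (by positivity)
          gcongr
      _ = C₁ * Q * ((D * 2 ^ s * δ) ^ m * δ ^ j) * ((m.factorial : ℝ) ^ s
          * (j.factorial : ℝ) ^ s) := by rw [hQ]; ring
      _ ≤ _ := by
          gcongr
          exact hpow _ (by positivity) le_rfl
  have h2 : D ^ m * √(m.factorial : ℝ) * (‖x‖ ^ N * I)
      ≤ C₂ * (C₁ * Q') * h ^ (m + j) * ((m + j).factorial : ℝ) ^ s := by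
    calc D ^ m * √(m.factorial : ℝ) * (‖x‖ ^ N * I)
        ≤ D ^ m * (C₂ * δ ^ m * (m.factorial : ℝ) ^ s)
            * (C₁ * δ ^ (N + j) * ((N.factorial : ℝ) * j.factorial) ^ s) := by
          exact mul_le_mul (mul_le_mul_of_nonneg_left (H₂ m) (by positivity)) (H₁ N j x)
            (by positivity) (by positivity)
      _ = C₂ * (C₁ * Q') * ((D * 1 * δ) ^ m * δ ^ j) * ((m.factorial : ℝ) ^ s
          * (j.factorial : ℝ) ^ s) := by
          rw [hQ', Real.mul_rpow (by positivity) (by positivity)]; ring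
      _ ≤ _ := by
          gcongr
          exact hpow _ zero_le_one h2s
  calc _ = D ^ m * (‖x‖ ^ (m + N) * I) + D ^ m * √(m.factorial : ℝ) * (‖x‖ ^ N * I) := by ring
    _ ≤ _ := by linarith

/-- A constant bounding integrals of functions whose product with a power of the norm is bounded. -/
def decayConst {E : Type*} [NormedAddCommGroup E] [MeasurableSpace E] (μ : Measure E) : ℝ :=
  2 ^ μ.integrablePower * ∫ x, (1 + ‖x‖) ^ (-(μ.integrablePower : ℝ)) ∂μ

lemma decayConst_nonneg {E : Type*} [NormedAddCommGroup E] [MeasurableSpace E] (μ : Measure E) :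
    0 ≤ decayConst μ :=
  mul_nonneg (by positivity) (integral_nonneg fun x => by positivity)

section Haar

variable {E : Type*} [NormedAddCommGroup E] [NormedSpace ℝ E] [FiniteDimensional ℝ E]
  [MeasurableSpace E] [BorelSpace E] (μ : Measure E) [μ.IsAddHaarMeasure]

lemma integrable_of_decay {f : E → ℂ} (hf : Continuous f) {C₁ C₂ : ℝ} (h₁ : ∀ x, ‖f x‖ ≤ C₁)
    (h₂ : ∀ x, ‖x‖ ^ μ.integrablePower * ‖f x‖ ≤ C₂) : Integrable f μ := by
  have := integrable_of_le_of_pow_mul_le (μ := μ) (k := 0) h₁ (by simpa using h₂)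
    hf.aestronglyMeasurable
  simp only [pow_zero, one_mul] at this
  exact (integrable_norm_iff hf.aestronglyMeasurable).1 this

lemma norm_integral_le_of_decay {f : E → ℂ} {C₁ C₂ : ℝ} (h₁ : ∀ x, ‖f x‖ ≤ C₁)
    (h₂ : ∀ x, ‖x‖ ^ μ.integrablePower * ‖f x‖ ≤ C₂) :
    ‖∫ x, f x ∂μ‖ ≤ decayConst μ * (C₁ + C₂) := by
  have := integral_pow_mul_le_of_le_of_pow_mul_le (μ := μ) (k := 0) h₁ (by simpa using h₂)
  simp only [pow_zero, one_mul] at this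
  exact (norm_integral_le_integral_norm f).trans this

lemma integral_hasLineDerivAt_eq_zero {f f' : E → ℂ} {v : E} (hf : Integrable f μ)
    (hf' : Integrable f' μ) (h : ∀ x, HasLineDerivAt ℝ f (f' x) x v) : ∫ x, f' x ∂μ = 0 := by
  have := integral_bilinear_hasLineDerivAt_right_eq_neg_left_of_integrable (μ := μ)
    (f := f) (f' := f') (g := fun _ => (1 : ℂ)) (g' := fun _ => (0 : ℂ)) (v := v)
    (B := ContinuousLinearMap.mul ℝ ℂ) (by simpa using hf') (by simp) (by simpa using hf)
    (fun x _ => h x) (fun x _ => by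
      unfold HasLineDerivAt; exact hasDerivAt_const _ _)
  simpa using this

/-- Iterated integration by parts along `v`, for a product of a Gaussian `G` whose logarithmic
derivative is `a - iθ` with the functions `P j`, where `P (j + 1)` is the derivative of `P j`. -/
lemma pow_mul_norm_integral_le {G a : E → ℂ} {P : ℕ → E → ℂ} {v : E} {θ : ℝ} {κ : ℂ}
    (hG : ∀ w, HasLineDerivAt ℝ G ((a w - Complex.I * θ) * G w) w v)
    (ha : ∀ w, HasLineDerivAt ℝ a κ w v)
    (hP : ∀ j w, HasLineDerivAt ℝ (P j) (P (j + 1) w) w v)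
    (hGc : Continuous G) (hac : Continuous a) (hPc : ∀ j, Continuous (P j))
    {B : ℕ → ℝ}
    (h₁ : ∀ m j w, ‖G w * gaussPoly κ m (a w) * P j w‖ ≤ B (m + j))
    (h₂ : ∀ m j w, ‖w‖ ^ μ.integrablePower * ‖G w * gaussPoly κ m (a w) * P j w‖ ≤ B (m + j))
    (n : ℕ) : |θ| ^ n * ‖∫ w, G w * P 0 w ∂μ‖ ≤ 2 ^ n * (decayConst μ * (2 * B n)) := by
  set T : ℕ → ℕ → E → ℂ := fun m j w => G w * gaussPoly κ m (a w) * P j w with hT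
  have hgp (m : ℕ) : Continuous (gaussPoly κ m) :=
    continuous_iff_continuousAt.2 fun a => (hasDerivAt_gaussPoly κ m a).continuousAt
  have hTi (m j : ℕ) : Integrable (T m j) μ :=
    integrable_of_decay μ ((hGc.mul ((hgp m).comp hac)).mul (hPc j)) (h₁ m j) (h₂ m j)
  have step (m j : ℕ) : Complex.I * θ * ∫ w, T m j w ∂μ
      = ∫ w, T (m + 1) j w ∂μ + ∫ w, T m (j + 1) w ∂μ := by
    have hd (w : E) : HasLineDerivAt ℝ (T m j)
        (T (m + 1) j w + T m (j + 1) w - Complex.I * θ * T m j w) w v := by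
      have h1 : HasLineDerivAt ℝ (fun w => gaussPoly κ m (a w))
          (m * gaussPoly κ (m - 1) (a w) * κ) w v := by
        have hw := ha w
        unfold HasLineDerivAt at hw ⊢
        refine HasDerivAt.comp_of_eq (0 : ℝ) (hasDerivAt_gaussPoly κ m (a w)) hw (by simp)
      have h2 := hG w
      have h3 := hP j w
      unfold HasLineDerivAt at h1 h2 h3 ⊢
      refine ((h2.mul h1).mul h3).congr_deriv ?_
      simp only [hT, gaussPoly_succ κ m, zero_smul, add_zero, Pi.mul_apply]
      ring
    have h0 := integral_hasLineDerivAt_eq_zero μ (hTi m j)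
      (((hTi (m + 1) j).add (hTi m (j + 1))).sub ((hTi m j).const_mul (Complex.I * θ))) hd
    have hadd := integral_add (hTi (m + 1) j) (hTi m (j + 1))
    have hsub := integral_sub (f := fun x => T (m + 1) j x + T m (j + 1) x)
      ((hTi (m + 1) j).add (hTi m (j + 1))) ((hTi m j).const_mul (Complex.I * θ))
    simp only [Pi.add_apply, Pi.sub_apply] at h0
    rw [hsub, hadd, integral_const_mul] at h0
    exact (sub_eq_zero.1 h0).symm
  have key (n : ℕ) : ∀ m j, |θ| ^ n * ‖∫ w, T m j w ∂μ‖
      ≤ 2 ^ n * (decayConst μ * (2 * B (m + j + n))) := by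
    induction n with
    | zero =>
      intro m j
      simpa [two_mul] using norm_integral_le_of_decay μ (h₁ m j) (h₂ m j)
    | succ n ih =>
      intro m j
      have h1 := ih (m + 1) j
      have h2 := ih m (j + 1)
      rw [show m + 1 + j + n = m + j + (n + 1) by ring] at h1
      rw [show m + (j + 1) + n = m + j + (n + 1) by ring] at h2
      have h3 : |θ| * ‖∫ w, T m j w ∂μ‖
          ≤ ‖∫ w, T (m + 1) j w ∂μ‖ + ‖∫ w, T m (j + 1) w ∂μ‖ := by
        have := congrArg norm (step m j)
        rw [norm_mul, norm_mul, Complex.norm_I, one_mul, Complex.norm_real, Real.norm_eq_abs]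
          at this
        exact this.le.trans (norm_add_le _ _)
      calc |θ| ^ (n + 1) * ‖∫ w, T m j w ∂μ‖ = |θ| ^ n * (|θ| * ‖∫ w, T m j w ∂μ‖) := by ring
        _ ≤ |θ| ^ n * (‖∫ w, T (m + 1) j w ∂μ‖ + ‖∫ w, T m (j + 1) w ∂μ‖) := by gcongr
        _ ≤ _ := by rw [mul_add, pow_succ]; linarith
  have := key n 0 0
  simpa [hT, gaussPoly] using this

end Haar

lemma hasLineDerivAt_iteratedFDeriv_apply_const {E : Type*} [NormedAddCommGroup E]
    [NormedSpace ℝ E] {f : E → ℂ} (hf : ContDiff ℝ ((⊤ : ℕ∞) : WithTop ℕ∞) f) (j : ℕ) (v y : E) :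
    HasLineDerivAt ℝ (fun y => iteratedFDeriv ℝ j f y fun _ => v)
      (iteratedFDeriv ℝ (j + 1) f y fun _ => v) y v := by
  have hd : DifferentiableAt ℝ (iteratedFDeriv ℝ j f) y :=
    (hf.differentiable_iteratedFDeriv (WithTop.coe_lt_coe.2 (ENat.natCast_lt_top j))) y
  exact (hd.hasFDerivAt.continuousMultilinear_apply_const (fun _ => v)).hasLineDerivAt v

section Oscillatory

variable {d : ℕ}

/-- The Gaussian integrand `e^{iρ(x) - i⟨x,ξ⟩}` with `ρ(x) = ⟨Tx,x⟩ + i⟨Sx,x⟩`. -/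
def gaussChirp (T S : Ed d →L[ℝ] Ed d) (ξ x : Ed d) : ℂ :=
  Complex.exp (Complex.I * (((⟪T x, x⟫ : ℝ) : ℂ) + Complex.I * ((⟪S x, x⟫ : ℝ) : ℂ))
    - Complex.I * ((⟪x, ξ⟫ : ℝ) : ℂ))

lemma continuous_gaussChirp (T S : Ed d →L[ℝ] Ed d) (ξ : Ed d) : Continuous (gaussChirp T S ξ) := by
  unfold gaussChirp
  fun_prop

lemma norm_gaussChirp (T S : Ed d →L[ℝ] Ed d) (ξ x : Ed d) :
    ‖gaussChirp T S ξ x‖ = Real.exp (-⟪S x, x⟫) := by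
  rw [gaussChirp, Complex.norm_exp]
  simp

lemma hasLineDerivAt_inner_self {T : Ed d →L[ℝ] Ed d} (hT : ∀ x y, ⟪T x, y⟫ = ⟪x, T y⟫)
    (x v : Ed d) : HasLineDerivAt ℝ (fun x => ((⟪T x, x⟫ : ℝ) : ℂ)) ((2 * ⟪T x, v⟫ : ℝ) : ℂ) x v := by
  have h := ((T.hasFDerivAt (x := x)).inner ℝ (hasFDerivAt_id x)).hasLineDerivAt v
  have h2 : HasLineDerivAt ℝ (fun x => (⟪T x, x⟫ : ℝ)) (2 * ⟪T x, v⟫) x v := by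
    unfold HasLineDerivAt at h ⊢
    refine h.congr_deriv ?_
    simp [hT v x, real_inner_comm v (T x)]
    ring
  unfold HasLineDerivAt at h2 ⊢
  exact h2.ofReal_comp

lemma hasLineDerivAt_gaussChirp {T S : Ed d →L[ℝ] Ed d} (hT : ∀ x y, ⟪T x, y⟫ = ⟪x, T y⟫)
    (hS : ∀ x y, ⟪S x, y⟫ = ⟪x, S y⟫) (ξ x v : Ed d) :
    HasLineDerivAt ℝ (gaussChirp T S ξ)
      ((Complex.I * ((2 * ⟪T x, v⟫ : ℝ) + Complex.I * (2 * ⟪S x, v⟫ : ℝ))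
        - Complex.I * (⟪v, ξ⟫ : ℝ)) * gaussChirp T S ξ x) x v := by
  have h1 := hasLineDerivAt_inner_self hT x v
  have h2 := hasLineDerivAt_inner_self hS x v
  have h3 : HasLineDerivAt ℝ (fun x => ((⟪x, ξ⟫ : ℝ) : ℂ)) ((⟪v, ξ⟫ : ℝ) : ℂ) x v := by
    have h := ((hasFDerivAt_id x).inner ℝ (hasFDerivAt_const ξ x)).hasLineDerivAt v
    have h' : HasLineDerivAt ℝ (fun x => (⟪x, ξ⟫ : ℝ)) ⟪v, ξ⟫ x v := by
      unfold HasLineDerivAt at h ⊢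
      exact h.congr_deriv (by simp)
    unfold HasLineDerivAt at h' ⊢
    exact h'.ofReal_comp
  unfold HasLineDerivAt at h1 h2 h3 ⊢
  have := (((h1.add (h2.const_mul Complex.I)).const_mul Complex.I).sub
    (h3.const_mul Complex.I)).cexp
  refine this.congr_deriv ?_
  simp only [zero_smul, add_zero, gaussChirp, Pi.add_apply, Pi.sub_apply]
  rw [mul_comm]

lemma abs_inner_le_of_posSemidef {S : Ed d →L[ℝ] Ed d} (hS : ∀ x y, ⟪S x, y⟫ = ⟪x, S y⟫)
    (hS0 : ∀ x, 0 ≤ ⟪S x, x⟫) (x : Ed d) {v : Ed d} (hv : ‖v‖ ≤ 1) :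
    |⟪S x, v⟫| ≤ √⟪S x, x⟫ * √‖S‖ := by
  have h1 := LinearMap.BilinForm.apply_mul_apply_le_of_forall_zero_le
    ((innerₗ (Ed d)).comp (S : Ed d →ₗ[ℝ] Ed d)) hS0 x v
  simp only [LinearMap.comp_apply, innerₗ_apply_apply, ContinuousLinearMap.coe_coe] at h1
  rw [hS v x, real_inner_comm (S x) v] at h1
  have h2 : ⟪S v, v⟫ ≤ ‖S‖ := by
    calc ⟪S v, v⟫ ≤ ‖S v‖ * ‖v‖ := real_inner_le_norm _ _
      _ ≤ (‖S‖ * ‖v‖) * ‖v‖ := by gcongr; exact S.le_opNorm v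
      _ ≤ (‖S‖ * 1) * 1 := by gcongr
      _ = ‖S‖ := by ring
  rw [← Real.sqrt_mul (hS0 x), ← Real.sqrt_sq_eq_abs]
  refine Real.sqrt_le_sqrt ?_
  rw [sq]
  exact h1.trans (mul_le_mul_of_nonneg_left h2 (hS0 x))

end Oscillatory

section Projection

variable {d : ℕ} {T S : Ed d →L[ℝ] Ed d} {s : ℝ} {ψ : Ed d → ℂ}

lemma norm_gaussChirp_mul_gaussPoly_mul_le (hS : ∀ x y, ⟪S x, y⟫ = ⟪x, S y⟫)
    (hS0 : ∀ x, 0 ≤ ⟪S x, x⟫) (ξ x y w : Ed d) (hw : ‖w‖ ≤ ‖y - x‖) {v : Ed d} (hv : ‖v‖ ≤ 1)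
    (m j : ℕ) :
    ‖gaussChirp T S ξ y
        * gaussPoly (2 * Complex.I * (⟪T v, v⟫ : ℝ) - 2 * (⟪S v, v⟫ : ℝ)) m
          (2 * Complex.I * (⟪T w, v⟫ : ℝ) - 2 * (⟪S y, v⟫ : ℝ))
        * iteratedFDeriv ℝ j ψ (y - x) (fun _ => v)‖
      ≤ 2 * ((3 * (2 * ‖T‖ + 2 * √‖S‖ + 2 * √(2 * ‖T‖ + 2 * ‖S‖) + 1)) ^ m
        * (‖y - x‖ ^ m + √(m.factorial : ℝ)) * ‖iteratedFDeriv ℝ j ψ (y - x)‖) := by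
  set t := √⟪S y, y⟫ with ht
  have hop (A : Ed d →L[ℝ] Ed d) (z : Ed d) : |⟪A z, v⟫| ≤ ‖A‖ * ‖z‖ := by
    calc |⟪A z, v⟫| ≤ ‖A z‖ * ‖v‖ := abs_real_inner_le_norm _ _
      _ ≤ (‖A‖ * ‖z‖) * 1 := by gcongr; exact A.le_opNorm z
      _ = _ := mul_one _
  have hop' (A : Ed d →L[ℝ] Ed d) : |⟪A v, v⟫| ≤ ‖A‖ :=
    (hop A v).trans (mul_le_of_le_one_right (norm_nonneg _) hv)
  have hκ : ‖2 * Complex.I * ((⟪T v, v⟫ : ℝ) : ℂ) - 2 * ((⟪S v, v⟫ : ℝ) : ℂ)‖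
      ≤ √(2 * ‖T‖ + 2 * ‖S‖) ^ 2 := by
    rw [Real.sq_sqrt (by positivity)]
    refine (norm_sub_le _ _).trans ?_
    simp only [norm_mul, Complex.norm_I, Complex.norm_real, Real.norm_eq_abs, mul_one,
      Complex.norm_ofNat]
    have := hop' T
    have := hop' S
    linarith
  have ha : ‖2 * Complex.I * ((⟪T w, v⟫ : ℝ) : ℂ) - 2 * ((⟪S y, v⟫ : ℝ) : ℂ)‖
      ≤ (2 * ‖T‖ + 2 * √‖S‖) * (‖y - x‖ + t) := by
    refine (norm_sub_le _ _).trans ?_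
    simp only [norm_mul, Complex.norm_I, Complex.norm_real, Real.norm_eq_abs, mul_one,
      Complex.norm_ofNat]
    have h1 : |⟪T w, v⟫| ≤ ‖T‖ * ‖y - x‖ := (hop T w).trans (by gcongr)
    have h2 : |⟪S y, v⟫| ≤ t * √‖S‖ := abs_inner_le_of_posSemidef hS hS0 y hv
    have h3 : 0 ≤ ‖T‖ * t := by positivity
    have h4 : 0 ≤ √‖S‖ * ‖y - x‖ := by positivity
    linarith
  have hP : ‖iteratedFDeriv ℝ j ψ (y - x) (fun _ => v)‖ ≤ ‖iteratedFDeriv ℝ j ψ (y - x)‖ := by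
    refine ((iteratedFDeriv ℝ j ψ (y - x)).le_opNorm _).trans ?_
    refine mul_le_of_le_one_right (norm_nonneg _) ?_
    simpa using pow_le_one₀ (norm_nonneg v) hv
  have hpoly := (norm_gaussPoly_le (Real.sqrt_nonneg _) hκ m _).trans
    (pow_le_pow_left₀ (by positivity) (add_le_add_left ha _) m)
  have hG : ‖gaussChirp T S ξ y‖ = Real.exp (-t ^ 2) := by
    rw [norm_gaussChirp, ht, Real.sq_sqrt (hS0 y)]
  have hE := exp_neg_sq_mul_add_pow_le (K := 2 * ‖T‖ + 2 * √‖S‖) (c := √(2 * ‖T‖ + 2 * ‖S‖))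
    (r := ‖y - x‖) (t := t) (by positivity) (by positivity) (by positivity) (by positivity) m
  rw [norm_mul, norm_mul, hG, ← mul_assoc 2]
  refine mul_le_mul ?_ hP (norm_nonneg _) (by positivity)
  exact (mul_le_mul_of_nonneg_left hpoly (Real.exp_nonneg _)).trans hE

variable (V : Submodule ℝ (Ed d))

lemma norm_le_norm_starProjection_add_sub (x : Ed d) (w : V) :
    ‖w‖ ≤ ‖V.starProjection x + w - x‖ := by
  have h : V.starProjection (V.starProjection x + w - x) = w := by
    have h1 : V.starProjection (w : Ed d) = w := V.starProjection_eq_self_iff.2 w.2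
    have h2 : V.starProjection (V.starProjection x) = V.starProjection x :=
      V.starProjection_eq_self_iff.2 (V.starProjection_apply_mem x)
    rw [map_sub, map_add, h1, h2]
    abel
  calc ‖w‖ = ‖V.starProjection (V.starProjection x + w - x)‖ := by rw [h]; rfl
    _ ≤ _ := V.norm_starProjection_apply_le _

lemma norm_sub_starProjection_le (x : Ed d) (w : V) :
    ‖x - V.starProjection x‖ ≤ ‖V.starProjection x + w - x‖ := by
  have h := norm_add_sq_eq_norm_sq_add_norm_sq_real (x := -(x - V.starProjection x))
    (y := (w : Ed d)) (by
      have h0 := V.starProjection_inner_eq_zero x w w.2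
      rw [inner_neg_left, h0, neg_zero])
  have he : V.starProjection x + w - x = -(x - V.starProjection x) + (w : Ed d) := by abel
  rw [he]
  rw [← norm_neg, mul_self_le_mul_self_iff (norm_nonneg _) (norm_nonneg _), h]
  exact le_add_of_nonneg_right (mul_self_nonneg _)

variable (μ : Measure V) [μ.IsAddHaarMeasure]

lemma integral_translate_starProjection (ξ x : Ed d) :
    ∫ w : V, gaussChirp T S ξ w * ψ (w - x) ∂μ
      = ∫ w : V, gaussChirp T S ξ (V.starProjection x + w)
        * ψ (V.starProjection x + w - x) ∂μ := by
  have := integral_add_left_eq_self (μ := μ) (fun w : V => gaussChirp T S ξ w * ψ (w - x))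
    ⟨V.starProjection x, V.starProjection_apply_mem x⟩
  rw [← this]
  rfl

lemma pow_norm_sub_starProjection_mul_le (hs : 1 / 2 < s) (hS0 : ∀ x, 0 ≤ ⟪S x, x⟫)
    (hψ : GSBound s ψ) {h : ℝ} (hh : 0 < h) :
    ∃ C, 0 ≤ C ∧ ∀ (n : ℕ) (x ξ : Ed d), ‖x - V.starProjection x‖ ^ n
      * ‖∫ w : V, gaussChirp T S ξ w * ψ (w - x) ∂μ‖ ≤ C * h ^ n * (n.factorial : ℝ) ^ s := by
  obtain ⟨C₁, hC₁, h₁⟩ := hψ.weighted hs le_rfl 0 hh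
  obtain ⟨C₂, hC₂, h₂⟩ := hψ.weighted hs le_rfl μ.integrablePower hh
  refine ⟨decayConst μ * (C₁ + C₂),
    mul_nonneg (decayConst_nonneg μ) (add_nonneg hC₁ hC₂), fun n x ξ => ?_⟩
  set p := V.starProjection x
  have key (w : V) : ‖((‖x - p‖ : ℝ) : ℂ) ^ n * (gaussChirp T S ξ (p + w) * ψ (p + w - x))‖
      ≤ 1 ^ n * (‖p + w - x‖ ^ n + √(n.factorial : ℝ)) * ‖iteratedFDeriv ℝ 0 ψ (p + w - x)‖ := by
    rw [norm_mul, norm_mul, norm_gaussChirp, norm_pow, Complex.norm_real, norm_norm,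
      norm_iteratedFDeriv_zero, one_pow, one_mul, ← mul_assoc]
    gcongr
    have hp := norm_sub_starProjection_le V x w
    calc ‖x - p‖ ^ n * Real.exp (-⟪S (p + w), p + w⟫) ≤ ‖p + w - x‖ ^ n * 1 := by
          gcongr
          exact Real.exp_le_one_iff.2 (neg_nonpos.2 (hS0 _))
      _ ≤ _ := by rw [mul_one]; exact le_add_of_nonneg_right (Real.sqrt_nonneg _)
  have hI := norm_integral_le_of_decay μ
    (f := fun w : V => ((‖x - p‖ : ℝ) : ℂ) ^ n * (gaussChirp T S ξ (p + w) * ψ (p + w - x)))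
    (C₁ := C₁ * h ^ n * (n.factorial : ℝ) ^ s) (C₂ := C₂ * h ^ n * (n.factorial : ℝ) ^ s)
    (fun w => (key w).trans (by simpa using h₁ n 0 (p + w - x)))
    (fun w => by
      refine (mul_le_mul (pow_le_pow_left₀ (norm_nonneg _)
        (norm_le_norm_starProjection_add_sub V x w) _) (key w) (norm_nonneg _)
        (by positivity)).trans ?_
      simpa [mul_assoc] using h₂ n 0 (p + w - x))
  rw [integral_const_mul, norm_mul, norm_pow, Complex.norm_real, norm_norm] at hI
  rw [integral_translate_starProjection]
  refine hI.trans (le_of_eq ?_)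
  ring

lemma pow_norm_starProjection_sub_mul_le (hs : 1 / 2 < s) (hT : ∀ x y, ⟪T x, y⟫ = ⟪x, T y⟫)
    (hS : ∀ x y, ⟪S x, y⟫ = ⟪x, S y⟫) (hS0 : ∀ x, 0 ≤ ⟪S x, x⟫)
    (hψc : ContDiff ℝ ((⊤ : ℕ∞) : WithTop ℕ∞) ψ) (hψ : GSBound s ψ) {h : ℝ} (hh : 0 < h) :
    ∃ C, 0 ≤ C ∧ ∀ (n : ℕ) (x ξ : Ed d),
      ‖V.starProjection (ξ - (2 : ℝ) • T (V.starProjection x))‖ ^ n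
      * ‖∫ w : V, gaussChirp T S ξ w * ψ (w - x) ∂μ‖ ≤ C * h ^ n * (n.factorial : ℝ) ^ s := by
  set D := 3 * (2 * ‖T‖ + 2 * √‖S‖ + 2 * √(2 * ‖T‖ + 2 * ‖S‖) + 1) with hD
  have hD1 : 1 ≤ D := by
    have h1 := norm_nonneg T
    have h2 := Real.sqrt_nonneg ‖S‖
    have h3 := Real.sqrt_nonneg (2 * ‖T‖ + 2 * ‖S‖)
    linarith
  have hh2 : 0 < h / 2 := by positivity
  obtain ⟨C₁, hC₁, h₁⟩ := hψ.weighted hs hD1 0 hh2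
  obtain ⟨C₂, hC₂, h₂⟩ := hψ.weighted hs hD1 μ.integrablePower hh2
  refine ⟨decayConst μ * (2 * (2 * (C₁ + C₂))),
    mul_nonneg (decayConst_nonneg μ) (by positivity), fun n x ξ => ?_⟩
  set p := V.starProjection x
  set η := V.starProjection (ξ - (2 : ℝ) • T p) with hη
  set v : V := ‖η‖⁻¹ • ⟨η, V.starProjection_apply_mem _⟩
  have hvη : (v : Ed d) = ‖η‖⁻¹ • η := rfl
  have hv1 : ‖(v : Ed d)‖ ≤ 1 := by
    rw [hvη, norm_smul, norm_inv, norm_norm]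
    exact inv_mul_le_one
  have hθ : ⟪(v : Ed d), ξ⟫ - 2 * ⟪(v : Ed d), T p⟫ = ‖η‖ := by
    have h1 : ⟪(v : Ed d), ξ - (2 : ℝ) • T p⟫ = ⟪(v : Ed d), η⟫ := by
      rw [hη, ← V.inner_starProjection_left_eq_right, V.starProjection_eq_self_iff.2 v.2]
    rw [inner_sub_right, inner_smul_right] at h1
    rw [h1, hvη, inner_smul_left, real_inner_self_eq_norm_sq]
    rcases eq_or_ne ‖η‖ 0 with h0 | h0
    · simp [h0]
    · simp only [conj_trivial]
      field_simp
  set κ : ℂ := 2 * Complex.I * (⟪T v, (v : Ed d)⟫ : ℝ) - 2 * (⟪S v, (v : Ed d)⟫ : ℝ) with hκ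
  set a : V → ℂ := fun w =>
    2 * Complex.I * (⟪T w, (v : Ed d)⟫ : ℝ) - 2 * (⟪S (p + w), (v : Ed d)⟫ : ℝ) with hadef
  have hlin (A : Ed d →L[ℝ] Ed d) (q : Ed d) (w : V) :
      HasDerivAt (fun t : ℝ => ((⟪A (q + (w + t • v : V)), (v : Ed d)⟫ : ℝ) : ℂ))
        ((⟪A v, (v : Ed d)⟫ : ℝ) : ℂ) 0 := by
    have he : (fun t : ℝ => (⟪A (q + (w + t • v : V)), (v : Ed d)⟫ : ℝ))
        = fun t => ⟪A (q + w), (v : Ed d)⟫ + t * ⟪A v, (v : Ed d)⟫ := by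
      funext t
      simp only [Submodule.coe_add, Submodule.coe_smul, map_add, map_smul, inner_add_left,
        real_inner_smul_left]
      ring
    have hd : HasDerivAt (fun t : ℝ => (⟪A (q + (w + t • v : V)), (v : Ed d)⟫ : ℝ))
        ⟪A v, (v : Ed d)⟫ 0 := by
      rw [he]
      simpa using ((hasDerivAt_id (0 : ℝ)).mul_const ⟪A v, (v : Ed d)⟫).const_add
        ⟪A (q + w), (v : Ed d)⟫
    exact hd.ofReal_comp
  have hcoe (w : V) (t : ℝ) : p + ((w + t • v : V) : Ed d) = p + w + t • (v : Ed d) := by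
    rw [Submodule.coe_add, Submodule.coe_smul, add_assoc]
  have hG (w : V) : HasLineDerivAt ℝ (fun w : V => gaussChirp T S ξ (p + w))
      ((a w - Complex.I * (‖η‖ : ℝ)) * gaussChirp T S ξ (p + w)) w v := by
    have hd := hasLineDerivAt_gaussChirp hT hS ξ (p + w) v
    unfold HasLineDerivAt at hd ⊢
    simp only [hcoe]
    refine hd.congr_deriv ?_
    congr 1
    rw [← hθ, hadef, map_add, inner_add_left, real_inner_comm (T p) (v : Ed d)]
    push_cast
    linear_combination (2 * ((⟪S (p + w), (v : Ed d)⟫ : ℝ) : ℂ)) * Complex.I_sq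
  have ha (w : V) : HasLineDerivAt ℝ a κ w v := by
    unfold HasLineDerivAt
    have h1 := (hlin T 0 w).const_mul (2 * Complex.I)
    have h2 := (hlin S p w).const_mul 2
    simp only [zero_add] at h1
    exact h1.sub h2
  have hP (j : ℕ) (w : V) : HasLineDerivAt ℝ
      (fun w : V => iteratedFDeriv ℝ j ψ (p + w - x) fun _ => (v : Ed d))
      (iteratedFDeriv ℝ (j + 1) ψ (p + w - x) fun _ => (v : Ed d)) w v := by
    have hd := hasLineDerivAt_iteratedFDeriv_apply_const hψc j (v : Ed d) (p + w - x)
    unfold HasLineDerivAt at hd ⊢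
    simp only [hcoe]
    convert hd using 3
    abel_nf
  have hB (m j : ℕ) (w : V) := norm_gaussChirp_mul_gaussPoly_mul_le (T := T) (ψ := ψ) hS hS0 ξ x
    (p + w) w (norm_le_norm_starProjection_add_sub V x w) hv1 m j
  rw [← hD] at hB
  have hpos (m : ℕ) : 0 ≤ (h / 2) ^ m * (m.factorial : ℝ) ^ s := by positivity
  have hmain := pow_mul_norm_integral_le μ (G := fun w : V => gaussChirp T S ξ (p + w)) (a := a)
    (P := fun j w => iteratedFDeriv ℝ j ψ (p + w - x) fun _ => (v : Ed d)) (v := v) (θ := ‖η‖)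
    (κ := κ) (B := fun n => 2 * (C₁ + C₂) * (h / 2) ^ n * (n.factorial : ℝ) ^ s) hG ha hP
    ((continuous_gaussChirp T S ξ).comp (by fun_prop)) (by fun_prop)
    (fun j => by
      have hc : Continuous (iteratedFDeriv ℝ j ψ) :=
        hψc.continuous_iteratedFDeriv (by exact_mod_cast le_top)
      have hc' : Continuous fun w : V => iteratedFDeriv ℝ j ψ (p + w - x) :=
        hc.comp (by fun_prop)
      exact (ContinuousMultilinearMap.apply ℝ (fun _ : Fin j => Ed d) ℂ
        fun _ => (v : Ed d)).continuous.comp hc')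
    (fun m j w => by
      have h1 := h₁ m j (p + w - x)
      have h2 := mul_nonneg hC₂ (hpos (m + j))
      rw [pow_zero, one_mul] at h1
      refine (hB m j w).trans ?_
      linarith)
    (fun m j w => by
      have h1 := h₂ m j (p + w - x)
      have h2 := mul_nonneg hC₁ (hpos (m + j))
      refine (mul_le_mul (pow_le_pow_left₀ (norm_nonneg _)
        (norm_le_norm_starProjection_add_sub V x w) _) (hB m j w) (norm_nonneg _)
        (by positivity)).trans ?_
      linarith) n
  rw [abs_norm] at hmain
  rw [integral_translate_starProjection]
  simp only [iteratedFDeriv_zero_apply] at hmain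
  refine hmain.trans (le_of_eq ?_)
  rw [div_pow]
  field_simp

end Projection

section Reduction

variable {d : ℕ}

lemma iteratedDeriv_cexp_neg_I (n : ℕ) :
    iteratedDeriv n (fun t : ℝ => Complex.exp (-(Complex.I * (t : ℂ))))
      = fun t : ℝ => (-Complex.I) ^ n * Complex.exp (-(Complex.I * (t : ℂ))) := by
  induction n with
  | zero => simp
  | succ n ih =>
    rw [iteratedDeriv_succ, ih]
    funext t
    have h : HasDerivAt (fun t : ℝ => -(Complex.I * (t : ℂ))) (-Complex.I) t := by
      exact ((hasDerivAt_id t).ofReal_comp.const_mul Complex.I).neg.congr_deriv (by simp)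
    rw [(h.cexp.const_mul ((-Complex.I) ^ n)).deriv]
    ring

lemma hasTemperateGrowth_cexp_neg_I_inner (ξ : Ed d) :
    Function.HasTemperateGrowth fun y : Ed d => Complex.exp (-(Complex.I * (⟪y, ξ⟫ : ℝ))) := by
  have h : Function.HasTemperateGrowth fun t : ℝ => Complex.exp (-(Complex.I * (t : ℂ))) := by
    refine ⟨(contDiff_const.mul Complex.ofRealCLM.contDiff).neg.cexp, fun n => ⟨0, 1, fun t => ?_⟩⟩
    rw [norm_iteratedFDeriv_eq_norm_iteratedDeriv, iteratedDeriv_cexp_neg_I, norm_mul, norm_pow,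
      norm_neg, Complex.norm_I, Complex.norm_exp]
    simp
  exact h.comp (Function.hasTemperateGrowth_inner_left ξ)

/-- A smooth function in the Gelfand–Shilov class is a Schwartz function. -/
def GSBound.toSchwartzMap {s : ℝ} {f : Ed d → ℂ} (hf : GSBound s f)
    (hc : ContDiff ℝ ((⊤ : ℕ∞) : WithTop ℕ∞) f) : SchwartzMap (Ed d) ℂ where
  toFun := f
  smooth' := hc
  decay' k n := by
    obtain ⟨C, _, hC⟩ := hf 1 one_pos
    exact ⟨_, hC k n⟩

lemma exists_schwartzMap_window {s : ℝ} {f : Ed d → ℂ} (hf : GSBound s f)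
    (hc : ContDiff ℝ ((⊤ : ℕ∞) : WithTop ℕ∞) f) (x ξ : Ed d) :
    ∃ g : SchwartzMap (Ed d) ℂ,
      ∀ y, g y = f (y - x) * Complex.exp (-(Complex.I * (⟪y, ξ⟫ : ℝ))) := by
  refine ⟨SchwartzMap.smulLeftCLM ℂ (fun y : Ed d => Complex.exp (-(Complex.I * (⟪y, ξ⟫ : ℝ))))
    (SchwartzMap.compSubConstCLM ℝ x (hf.toSchwartzMap hc)), fun y => ?_⟩
  rw [SchwartzMap.smulLeftCLM_apply_apply (hasTemperateGrowth_cexp_neg_I_inner ξ), smul_eq_mul,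
    mul_comm]
  rfl

lemma GSBound.conj {s : ℝ} {f : Ed d → ℂ} (hf : GSBound s f) :
    GSBound s fun x => (starRingEnd ℂ) (f x) := by
  intro h hh
  obtain ⟨C, hC0, hC⟩ := hf h hh
  refine ⟨C, hC0, fun m j x => ?_⟩
  have hj : ‖iteratedFDeriv ℝ j (fun x => (starRingEnd ℂ) (f x)) x‖ = ‖iteratedFDeriv ℝ j f x‖ :=
    Complex.conjLIE.norm_iteratedFDeriv_comp_left f x j
  rw [hj]
  exact hC m j x

lemma integral_hausdorffMeasure_submodule (V : Submodule ℝ (Ed d)) (r : ℝ) (hr : 0 ≤ r)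
    (f : Ed d → ℂ) :
    ∫ x in (V : Set (Ed d)), f x ∂(μH[r]) = ∫ w : V, f w ∂(μH[r]) := by
  have hm := (isometry_subtype_coe (s := (V : Set (Ed d)))).map_hausdorffMeasure (Or.inl hr)
  rw [Subtype.range_coe] at hm
  rw [← hm]
  exact (MeasurableEmbedding.subtype_coe
    (V.closed_of_finiteDimensional).measurableSet).integral_map f

lemma qf_eq_inner (B : Matrix (Fin d) (Fin d) ℝ) (x : Ed d) :
    qf B x = ⟪Matrix.toEuclideanCLM (𝕜 := ℝ) B x, x⟫ := by
  rw [real_inner_comm, Matrix.inner_toEuclideanCLM]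
  simp only [qf, dotProduct, Matrix.mulVec, mul_comm]

lemma inner_toEuclideanCLM_comm {B : Matrix (Fin d) (Fin d) ℝ} (hB : B.IsSymm) (x y : Ed d) :
    ⟪Matrix.toEuclideanCLM (𝕜 := ℝ) B x, y⟫ = ⟪x, Matrix.toEuclideanCLM (𝕜 := ℝ) B y⟫ := by
  rw [real_inner_comm, Matrix.inner_toEuclideanCLM, Matrix.inner_toEuclideanCLM,
    Matrix.dotProduct_mulVec, ← Matrix.mulVec_transpose, hB.eq, dotProduct_comm]

lemma inner_toEuclideanCLM_self_nonneg {B : Matrix (Fin d) (Fin d) ℝ} (hB : B.PosSemidef)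
    (x : Ed d) : 0 ≤ ⟪Matrix.toEuclideanCLM (𝕜 := ℝ) B x, x⟫ := by
  rw [real_inner_comm, Matrix.inner_toEuclideanCLM]
  simpa using hB.dotProduct_mulVec_nonneg x.ofLp

end Reduction

theorem statement18 (d k : ℕ) (s : ℝ) (hs : 1/2 < s) (hk : k ≤ d)
    (V : Submodule ℝ (Ed d)) (hV : Module.finrank ℝ V = k)
    (Rr Ri : Matrix (Fin d) (Fin d) ℝ) (hRr : Rr.IsSymm) (hRi : Ri.IsSymm)
    (hRi' : Ri.PosSemidef)
    (u : TD d)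
    (hu : ∀ g : SchwartzMap (Ed d) ℂ,
      u g = ∫ x in (V : Set (Ed d)),
        Complex.exp (Complex.I * (((qf Rr x : ℝ) : ℂ) + Complex.I * ((qf Ri x : ℝ) : ℂ)))
          * g x ∂(μH[(k : ℝ)]))
    (φ : Ed d → ℂ) (hφ : φ ∈ SigmaGS s d) (hφ0 : φ ≠ 0)
    (W : Ed d × Ed d → ℂ) (hW : IsSTFT u φ W) :
    WFs s W ⊆
      {z : Ed d × Ed d | z.1 ∈ (V : Set (Ed d)) ∧
        ∃ η ∈ (Vᗮ : Set (Ed d)), ∀ i : Fin d, z.2 i = 2 * (∑ j, Rr i j * z.1 j) + η i}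
      \ {0} := by
  subst hV
  have hs0 : 0 < s := by linarith
  set T := Matrix.toEuclideanCLM (𝕜 := ℝ) Rr with hTdef
  set S := Matrix.toEuclideanCLM (𝕜 := ℝ) Ri with hSdef
  have hT : ∀ x y, ⟪T x, y⟫ = ⟪x, T y⟫ := inner_toEuclideanCLM_comm hRr
  have hS : ∀ x y, ⟪S x, y⟫ = ⟪x, S y⟫ := inner_toEuclideanCLM_comm hRi
  have hS0 : ∀ x, 0 ≤ ⟪S x, x⟫ := inner_toEuclideanCLM_self_nonneg hRi'
  set ψ : Ed d → ℂ := fun x => (starRingEnd ℂ) (φ x)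
  have hψ : GSBound s ψ := (gsBound_of_mem_SigmaGS hs0.le hφ).conj
  have hψc : ContDiff ℝ ((⊤ : ℕ∞) : WithTop ℕ∞) ψ := Complex.conjCLE.contDiff.comp hφ.1
  set μ : Measure V := μH[(Module.finrank ℝ V : ℝ)]
  have : μ.IsAddHaarMeasure := isAddHaarMeasure_hausdorffMeasure
  have hWI (z : Ed d × Ed d) :
      W z = ∫ w : V, gaussChirp T S z.2 w * ψ (w - z.1) ∂μ := by
    obtain ⟨g, hg⟩ := exists_schwartzMap_window hψ hψc z.1 z.2
    rw [hW z.1 z.2 g hg, hu, integral_hausdorffMeasure_submodule V _ (by positivity)]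
    refine integral_congr_ae (Eventually.of_forall fun w => ?_)
    simp only [gaussChirp, hg, qf_eq_inner, ← hTdef, ← hSdef]
    rw [sub_eq_add_neg _ (Complex.I * _), Complex.exp_add]
    ring
  set La : Ed d × Ed d →L[ℝ] Ed d :=
    (ContinuousLinearMap.id ℝ (Ed d) - V.starProjection).comp
      (ContinuousLinearMap.fst ℝ (Ed d) (Ed d))
  set Lb : Ed d × Ed d →L[ℝ] Ed d :=
    V.starProjection.comp (ContinuousLinearMap.snd ℝ (Ed d) (Ed d)
      - (2 : ℝ) • (T.comp (V.starProjection.comp (ContinuousLinearMap.fst ℝ (Ed d) (Ed d)))))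
   
  intro z hz
  refine ⟨?_, hz.1⟩
  have ha : La z = 0 := by
    by_contra h0
    refine notMem_WFs_of_pow_mul_le hs0 La (fun h hh => ?_) h0 hz
    obtain ⟨C, hC, H⟩ := pow_norm_sub_starProjection_mul_le V μ (T := T) hs hS0 hψ hh
    exact ⟨C, hC, fun n z => by rw [hWI]; exact H n z.1 z.2⟩
  have hb : Lb z = 0 := by
    by_contra h0
    refine notMem_WFs_of_pow_mul_le hs0 Lb (fun h hh => ?_) h0 hz
    obtain ⟨C, hC, H⟩ := pow_norm_starProjection_sub_mul_le V μ hs hT hS hS0 hψc hψ hh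
    exact ⟨C, hC, fun n z => by rw [hWI]; exact H n z.1 z.2⟩
  have hz1 : V.starProjection z.1 = z.1 := (sub_eq_zero.1 ha).symm
  have hz2 : V.starProjection (z.2 - (2 : ℝ) • T (V.starProjection z.1)) = 0 := hb
  rw [hz1, V.starProjection_apply_eq_zero_iff] at hz2
  refine ⟨V.starProjection_eq_self_iff.1 hz1, _, hz2, fun i => ?_⟩
  have hi : T z.1 i = ∑ j, Rr i j * z.1 j := by
    rw [hTdef, Matrix.ofLp_toEuclideanCLM]
    rfl
  simp [hi]

end
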